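/- Let n ≥ 2 and let x ∈ D_n \ ∪_{k=1}^{n−1} D_k. Let (γ_i) be the lexicographically smallest sequence in U_{q_n}' satisfying ((γ_i))_{q_{n−1}} > x. If q* ∈ (q_{n−1}, q_n] satisfies x = Σ_{i=1}^∞ γ_i (q*)^{-i}, then q_s(x) = q*. -/

import Mathlib

open Filter Topology

noncomputable section

/-- The value `Σ_{i≥0} d i / q^(i+1)` of a (0-indexed) digit sequence `d` in base `q`;
this corresponds to `((d_i)_{i≥1})_q` with `d_i = d (i-1)`. -/
def seqVal (q : ℝ) (d : ℕ → ℕ) : ℝ := ∑' i : ℕ, (d i : ℝ) / q ^ (i + 1)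

/-- `d` is a `q`-expansion of `x` with digits in `{0,1}`. -/
def IsExpansion (q x : ℝ) (d : ℕ → ℕ) : Prop :=
  (∀ i, d i ≤ 1) ∧ x = seqVal q d

/-- `x` has a unique `q`-expansion. -/
def HasUniqueExpansion (q x : ℝ) : Prop := ∃! d : ℕ → ℕ, IsExpansion q x d

/-- The set `U(x)` of univoque bases of `x`. -/
def UBases (x : ℝ) : Set ℝ := {q | 1 < q ∧ q < 2 ∧ HasUniqueExpansion q x}

/-- `q_s(x) = inf U(x)`. -/
def qs (x : ℝ) : ℝ := sInf (UBases x)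

/-- The univoque set `U_q` of `x ∈ [0, 1/(q-1)]` with a unique `q`-expansion. -/
def Uset (q : ℝ) : Set ℝ :=
  {x | x ∈ Set.Icc 0 (1 / (q - 1)) ∧ HasUniqueExpansion q x}

/-- The set `U_q'` of digit sequences which are the unique `q`-expansion of their value. -/
def USeq (q : ℝ) : Set (ℕ → ℕ) :=
  {d | (∀ i, d i ≤ 1) ∧ ∀ e : ℕ → ℕ, IsExpansion q (seqVal q d) e → e = d}

/-- The Thue–Morse sequence: `τ 0 = 0`, `τ (2n) = τ n`, `τ (2n+1) = 1 - τ n`. -/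
def IsThueMorse (τ : ℕ → ℕ) : Prop :=
  τ 0 = 0 ∧ (∀ n, τ (2 * n) = τ n) ∧ ∀ n, τ (2 * n + 1) = 1 - τ n

/-- `q` is the Komornik–Loreti constant: the base in `(1,2)` with `1 = Σ_{i≥1} τ_i q^{-i}`. -/
def IsKL (τ : ℕ → ℕ) (q : ℝ) : Prop :=
  1 < q ∧ q < 2 ∧ (1 : ℝ) = ∑' i : ℕ, (τ (i + 1) : ℝ) / q ^ (i + 1)

/-- `Q` is the sequence of bases `q_n`: `Q 0 = 1` and for `n ≥ 1`, `Q n` is the root in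
`(1,2)` of `1 = Σ_{i=1}^{2^n} τ_i q^{-i}`. -/
def IsBaseSeq (τ : ℕ → ℕ) (Q : ℕ → ℝ) : Prop :=
  Q 0 = 1 ∧ ∀ n, 1 ≤ n → 1 < Q n ∧ Q n < 2 ∧
    (1 : ℝ) = ∑ i ∈ Finset.range (2 ^ n), (τ (i + 1) : ℝ) / (Q n) ^ (i + 1)

/-- `D_n = ⋃_{q ∈ (q_{n-1}, q_n]} U_q`. -/
def D (Q : ℕ → ℝ) (n : ℕ) : Set ℝ := ⋃ q ∈ Set.Ioc (Q (n - 1)) (Q n), Uset q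

/-- The golden ratio. -/
def qG : ℝ := (1 + Real.sqrt 5) / 2

/-- Strict lexicographical order on digit sequences. -/
def seqLt (c d : ℕ → ℕ) : Prop := ∃ n, (∀ i, i < n → c i = d i) ∧ c n < d n

/-- The word `τ_1 ⋯ τ_m`. -/
def tmPrefix (τ : ℕ → ℕ) (m : ℕ) : List ℕ := (List.range m).map fun i => τ (i + 1)

/-- `w⁻`: decrease the last digit of a word by 1. -/
def lastDec (w : List ℕ) : List ℕ := w.dropLast ++ [w.getLastD 0 - 1]

/-- `w⁺`: increase the last digit of a word by 1. -/
def lastInc (w : List ℕ) : List ℕ := w.dropLast ++ [w.getLastD 0 + 1]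

/-- The reflection of a word. -/
def reflect (w : List ℕ) : List ℕ := w.map fun d => 1 - d

/-- The infinite sequence given by the prefix `p` followed by periodic repetition of `w`. -/
def prefPeriodic (p w : List ℕ) : ℕ → ℕ := fun j =>
  if j < p.length then p.getD j 0 else w.getD ((j - p.length) % w.length) 0

/-- `z_n = ((τ_1⋯τ_{2^{n-1}})(τ_{2^{n-1}+1}⋯τ_{2^n})^∞)_{q_n}`. -/
def zVal (τ : ℕ → ℕ) (Q : ℕ → ℝ) (n : ℕ) : ℝ :=
  seqVal (Q n) (prefPeriodic (tmPrefix τ (2 ^ (n - 1)))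
    ((List.range (2 ^ (n - 1))).map fun i => τ (2 ^ (n - 1) + (i + 1))))

/-- `z_{1,k} = Σ_{i=1}^k q_G^{-i} + 1/(q_G^k (q_G^2 - 1))`. -/
def z1 (k : ℕ) : ℝ :=
  (∑ i ∈ Finset.range k, 1 / qG ^ (i + 1)) + 1 / (qG ^ k * (qG ^ 2 - 1))

/-- digits in `{0,1}` -/
def Bin (d : ℕ → ℕ) : Prop := ∀ i, d i ≤ 1

/-- shift -/
def shf (k : ℕ) (d : ℕ → ℕ) : ℕ → ℕ := fun i => d (i + k)

/-- reflection of a sequence -/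
def flp (d : ℕ → ℕ) : ℕ → ℕ := fun i => 1 - d i

lemma Bin.shf {d : ℕ → ℕ} (h : Bin d) (k : ℕ) : Bin (shf k d) := fun i => h _

lemma Bin.flp (d : ℕ → ℕ) : Bin (flp d) := fun i => by unfold _root_.flp; omega

lemma flp_flp {d : ℕ → ℕ} (h : Bin d) : flp (flp d) = d := by
  funext i; have := h i; unfold flp; omega

lemma geo_hasSum {q : ℝ} (hq : 1 < q) : HasSum (fun i : ℕ => 1 / q ^ (i + 1)) (1 / (q - 1)) := by
  have h1 : HasSum (fun i : ℕ => (1 / q) ^ i) (1 - 1 / q)⁻¹ :=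
    hasSum_geometric_of_lt_one (by positivity) (by rw [div_lt_one (by linarith)]; exact hq)
  have h2 := h1.mul_left (1 / q)
  have h0 : q ≠ 0 := by positivity
  have h3 : q - 1 ≠ 0 := by linarith
  have e1 : (fun i : ℕ => 1 / q ^ (i + 1)) = fun i : ℕ => 1 / q * (1 / q) ^ i := by
    funext i; rw [div_pow, one_pow, pow_succ]; field_simp
  have e2 : 1 / (q - 1) = 1 / q * (1 - 1 / q)⁻¹ := by
    have h4 : 1 - 1 / q = (q - 1) / q := by field_simp
    rw [h4, inv_div]; field_simp
  rw [e1, e2]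
  exact h2

lemma summ {q : ℝ} (hq : 1 < q) {d : ℕ → ℕ} (h : Bin d) :
    Summable (fun i : ℕ => (d i : ℝ) / q ^ (i + 1)) := by
  refine Summable.of_nonneg_of_le (fun i => by positivity) (fun i => ?_) (geo_hasSum hq).summable
  have : (d i : ℝ) ≤ 1 := by exact_mod_cast h i
  gcongr

lemma seqVal_nonneg {q : ℝ} (hq : 1 < q) (d : ℕ → ℕ) : 0 ≤ seqVal q d :=
  tsum_nonneg (fun i => by positivity)

lemma seqVal_le {q : ℝ} (hq : 1 < q) {d : ℕ → ℕ} (h : Bin d) : seqVal q d ≤ 1 / (q - 1) := by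
  rw [← (geo_hasSum hq).tsum_eq]
  refine (summ hq h).tsum_le_tsum (fun i => ?_) (geo_hasSum hq).summable
  have : (d i : ℝ) ≤ 1 := by exact_mod_cast h i
  gcongr

lemma seqVal_flp {q : ℝ} (hq : 1 < q) {d : ℕ → ℕ} (h : Bin d) :
    seqVal q (flp d) = 1 / (q - 1) - seqVal q d := by
  have h1 := (geo_hasSum hq).sub (summ hq h).hasSum
  unfold seqVal
  rw [← h1.tsum_eq]
  congr 1
  funext i
  unfold flp
  rw [Nat.cast_sub (h i)]
  push_cast
  ring

lemma seqVal_split {q : ℝ} (hq : 1 < q) {d : ℕ → ℕ} (h : Bin d) (k : ℕ) :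
    seqVal q d = ∑ i ∈ Finset.range k, (d i : ℝ) / q ^ (i + 1)
      + (1 / q ^ k) * seqVal q (shf k d) := by
  have h0 : q ≠ 0 := by positivity
  unfold seqVal
  rw [← (summ hq h).sum_add_tsum_nat_add k, ← tsum_mul_left]
  congr 2
  funext i
  unfold shf
  field_simp
  ring

lemma seqVal_diff {q : ℝ} (hq : 1 < q) {c d : ℕ → ℕ} (hc : Bin c) (hd : Bin d) (j : ℕ)
    (hj : ∀ i, i < j → c i = d i) :
    seqVal q c - seqVal q d = (1 / q ^ (j + 1)) *
      ((c j : ℝ) - d j + seqVal q (shf (j + 1) c) - seqVal q (shf (j + 1) d)) := by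
  rw [seqVal_split hq hc (j + 1), seqVal_split hq hd (j + 1), Finset.sum_range_succ,
    Finset.sum_range_succ]
  have : ∑ i ∈ Finset.range j, (c i : ℝ) / q ^ (i + 1)
      = ∑ i ∈ Finset.range j, (d i : ℝ) / q ^ (i + 1) :=
    Finset.sum_congr rfl (fun i hi => by rw [hj i (Finset.mem_range.1 hi)])
  rw [this]
  ring

lemma seqVal_zero {q : ℝ} {d : ℕ → ℕ} (h : ∀ i, d i = 0) : seqVal q d = 0 := by
  unfold seqVal; simp [h]

lemma seqVal_lt {p q : ℝ} (hp : 1 < p) (hpq : p < q) {d : ℕ → ℕ} (h : Bin d)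
    (hne : ∃ i, d i ≠ 0) : seqVal q d < seqVal p d := by
  obtain ⟨k, hk⟩ := hne
  have hk' : (0 : ℝ) < d k := by exact_mod_cast Nat.pos_of_ne_zero hk
  refine Summable.tsum_lt_tsum (i := k) (fun i => ?_) ?_ (summ (hp.trans hpq) h) (summ hp h)
  · have : 0 < p := by linarith
    gcongr
  · have h0 : 0 < p := by linarith
    apply div_lt_div_of_pos_left hk' (by positivity)
    exact pow_lt_pow_left₀ hpq h0.le (by omega)

lemma lex_tri (c d : ℕ → ℕ) : c = d ∨ seqLt c d ∨ seqLt d c := by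
  classical
  by_cases h : c = d
  · exact Or.inl h
  · right
    have hex : ∃ i, c i ≠ d i := by
      by_contra hh; push Not at hh; exact h (funext hh)
    have h1 := Nat.find_spec hex
    have h2 : ∀ i, i < Nat.find hex → c i = d i := fun i hi => by
      have := Nat.find_min hex hi; simpa using this
    rcases lt_or_gt_of_ne h1 with h3 | h3
    · exact Or.inl ⟨_, h2, h3⟩
    · exact Or.inr ⟨_, fun i hi => (h2 i hi).symm, h3⟩

/-- remainders of the greedy algorithm -/
def rem (q y : ℝ) : ℕ → ℝ
  | 0 => y
  | k + 1 => if 1 ≤ q * rem q y k then q * rem q y k - 1 else q * rem q y k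

open Classical in
/-- digits of the greedy algorithm -/
def dig (q y : ℝ) (k : ℕ) : ℕ := if 1 ≤ q * rem q y k then 1 else 0

lemma exists_expansion {q y : ℝ} (hq : 1 < q) (hq2 : q < 2) (h0 : 0 ≤ y) (h1 : y ≤ 1 / (q - 1)) :
    ∃ d, Bin d ∧ seqVal q d = y := by
  have hqp : 0 < q := by linarith
  have hq1 : 0 < q - 1 := by linarith
  have hb : ∀ k, 0 ≤ rem q y k ∧ rem q y k ≤ 1 / (q - 1) := by
    intro k
    induction k with
    | zero => exact ⟨h0, h1⟩
    | succ k ih =>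
      unfold rem
      split_ifs with h
      · refine ⟨by linarith, ?_⟩
        have h2 : q * rem q y k ≤ q * (1 / (q - 1)) := by
          apply mul_le_mul_of_nonneg_left ih.2 hqp.le
        have h3 : q * (1 / (q - 1)) = 1 + 1 / (q - 1) := by field_simp; ring
        linarith
      · refine ⟨mul_nonneg hqp.le ih.1, ?_⟩
        have h3 : 1 ≤ 1 / (q - 1) := by rw [le_div_iff₀ hq1]; linarith
        linarith
  have hB : Bin (dig q y) := fun i => by unfold dig; split_ifs <;> omega
  have hs : ∀ k, ∑ i ∈ Finset.range k, (dig q y i : ℝ) / q ^ (i + 1)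
      = y - rem q y k / q ^ k := by
    intro k
    induction k with
    | zero => simp [rem]
    | succ k ih =>
      rw [Finset.sum_range_succ, ih]
      by_cases h : 1 ≤ q * rem q y k
      · simp only [dig, rem, if_pos h]; push_cast; field_simp; ring
      · simp only [dig, rem, if_neg h]; push_cast; field_simp; ring
  refine ⟨dig q y, hB, ?_⟩
  have t1 := (summ hq hB).hasSum.tendsto_sum_nat
  have t2 : Tendsto (fun k => y - rem q y k / q ^ k) atTop (𝓝 (y - 0)) := by
    refine tendsto_const_nhds.sub ?_
    have t3 : Tendsto (fun k : ℕ => (1 / (q - 1)) / q ^ k) atTop (𝓝 0) :=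
      tendsto_const_nhds.div_atTop (tendsto_pow_atTop_atTop_of_one_lt hq)
    refine squeeze_zero (fun k => div_nonneg (hb k).1 (by positivity)) (fun k => ?_) t3
    have := (hb k).2
    gcongr
  simp only [hs] at t1
  have := tendsto_nhds_unique t1 t2
  simpa [seqVal] using this

/-- value criterion for uniqueness -/
def Crit (q : ℝ) (d : ℕ → ℕ) : Prop :=
  ∀ m, (d m = 0 → seqVal q (shf (m + 1) d) < 1) ∧
    (d m = 1 → seqVal q (shf (m + 1) (flp d)) < 1)

lemma USeq_half {q : ℝ} (hq : 1 < q) (hq2 : q < 2) {d : ℕ → ℕ} (h : d ∈ USeq q) (m : ℕ)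
    (hm : d m = 0) : seqVal q (shf (m + 1) d) < 1 := by
  by_contra hc
  push Not at hc
  have hd : Bin d := h.1
  have hle := seqVal_le hq (hd.shf (m + 1))
  obtain ⟨e, he, hev⟩ := exists_expansion hq hq2 (y := seqVal q (shf (m + 1) d) - 1)
    (by linarith) (by linarith)
  let f : ℕ → ℕ := fun i => if i < m then d i else if i = m then 1 else e (i - (m + 1))
  have hf : Bin f := fun i => by
    simp only [f]; split_ifs
    · exact hd i
    · exact le_rfl
    · exact he _
  have hfs : shf (m + 1) f = e := by
    funext i
    have h1 : ¬ (i + (m + 1) < m) := by omega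
    have h2 : ¬ (i + (m + 1) = m) := by omega
    simp only [f, shf, h1, h2, if_false]
    congr 1; omega
  have hfm : f m = 1 := by simp [f]
  have hdiff := seqVal_diff hq hf hd m (fun i hi => by simp [f, hi])
  rw [hfs, hev, hfm, hm] at hdiff
  have : seqVal q f - seqVal q d = 0 := by rw [hdiff]; push_cast; ring
  have := h.2 f ⟨hf, by linarith⟩
  rw [this] at hfm; omega

lemma USeq_flp {q : ℝ} (hq : 1 < q) {d : ℕ → ℕ} (h : d ∈ USeq q) : flp d ∈ USeq q := by
  refine ⟨Bin.flp d, fun e he => ?_⟩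
  have hd : Bin d := h.1
  have h1 := he.2
  rw [seqVal_flp hq hd] at h1
  have h2 := h.2 (flp e) ⟨Bin.flp e, by rw [seqVal_flp hq he.1]; linarith⟩
  rw [← h2, flp_flp he.1]

lemma shf_flp (k : ℕ) (d : ℕ → ℕ) : shf k (flp d) = flp (shf k d) := rfl

lemma USeq_iff {q : ℝ} (hq : 1 < q) (hq2 : q < 2) {d : ℕ → ℕ} :
    d ∈ USeq q ↔ Bin d ∧ Crit q d := by
  constructor
  · intro h
    refine ⟨h.1, fun m => ⟨USeq_half hq hq2 h m, fun hm => ?_⟩⟩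
    exact USeq_half hq hq2 (USeq_flp hq h) m (by simp [flp, hm])
  · rintro ⟨hd, hc⟩
    refine ⟨hd, fun e he => ?_⟩
    have hev := he.2
    have heB : Bin e := he.1
    have hqp : 0 < q := by linarith
    rcases lex_tri e d with h | ⟨j, hj, hlt⟩ | ⟨j, hj, hlt⟩
    · exact h
    · exfalso
      have h1 : e j = 0 := by have := hd j; omega
      have h2 : d j = 1 := by have := hd j; omega
      have h3 := seqVal_diff hq heB hd j hj
      have h4 := (hc j).2 h2
      rw [shf_flp, seqVal_flp hq (hd.shf _)] at h4
      have h5 := seqVal_le hq (heB.shf (j + 1))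
      rw [← hev, sub_self] at h3
      have h6 : (0 : ℝ) < 1 / q ^ (j + 1) := by positivity
      have h7 := (mul_eq_zero.1 h3.symm).resolve_left h6.ne'
      rw [h1, h2] at h7
      push_cast at h7
      linarith
    · exfalso
      have h1 : d j = 0 := by have := heB j; omega
      have h2 : e j = 1 := by have := heB j; omega
      have h3 := seqVal_diff hq hd heB j hj
      have h4 := (hc j).1 h1
      have h5 := seqVal_nonneg hq (shf (j + 1) e)
      rw [← hev, sub_self] at h3
      have h6 : (0 : ℝ) < 1 / q ^ (j + 1) := by positivity
      have h7 := (mul_eq_zero.1 h3.symm).resolve_left h6.ne'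
      rw [h1, h2] at h7
      push_cast at h7
      linarith

lemma lt_one_mono {p q : ℝ} (hp : 1 < p) (hpq : p < q) {d : ℕ → ℕ} (h : Bin d)
    (h1 : seqVal p d ≤ 1) : seqVal q d < 1 := by
  by_cases hz : ∃ i, d i ≠ 0
  · exact (seqVal_lt hp hpq h hz).trans_le h1
  · push Not at hz
    rw [seqVal_zero hz]; norm_num

lemma USeq_mono {p q : ℝ} (hp : 1 < p) (hpq : p < q) (hq : q < 2) {d : ℕ → ℕ}
    (h : d ∈ USeq p) : d ∈ USeq q := by
  rw [USeq_iff hp (by linarith)] at h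
  rw [USeq_iff (by linarith) hq]
  exact ⟨h.1, fun m => ⟨fun hm => lt_one_mono hp hpq (Bin.shf h.1 _) ((h.2 m).1 hm).le,
    fun hm => lt_one_mono hp hpq ((Bin.flp d).shf _) ((h.2 m).2 hm).le⟩⟩

lemma USeq_lex_lt {q : ℝ} (hq : 1 < q) (hq2 : q < 2) {c d : ℕ → ℕ} (hc : c ∈ USeq q)
    (hd : d ∈ USeq q) (h : seqLt c d) : seqVal q c < seqVal q d := by
  rw [USeq_iff hq hq2] at hc hd
  obtain ⟨j, hj, hlt⟩ := h
  have hdj := hd.1 j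
  have h1 : c j = 0 := by omega
  have h2 : d j = 1 := by omega
  have h3 := seqVal_diff hq hc.1 hd.1 j hj
  have h4 := (hc.2 j).1 h1
  have h5 := seqVal_nonneg hq (shf (j + 1) d)
  have h6 : (0 : ℝ) < 1 / q ^ (j + 1) := by positivity
  rw [h1, h2] at h3
  push_cast at h3
  have : (1 / q ^ (j + 1)) * (0 - 1 + seqVal q (shf (j + 1) c) - seqVal q (shf (j + 1) d)) < 0 :=
    mul_neg_of_pos_of_neg h6 (by linarith)
  linarith

lemma shf_shf (a b : ℕ) (d : ℕ → ℕ) : shf a (shf b d) = shf (a + b) d := by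
  funext i; simp [shf, add_assoc]

lemma lex_le_one_aux {q : ℝ} (hq : 1 < q) {a d : ℕ → ℕ} (ha : Bin a) (hd : Bin d)
    (hav : seqVal q a = 1)
    (h : ∀ m, d m = 0 → ¬ seqLt a (shf (m + 1) d)) (k : ℕ) :
    ∀ m, d m = 0 → seqVal q (shf (m + 1) d) ≤ 1 + (1 / (q - 1)) / q ^ k := by
  have hqp : 0 < q := by linarith
  have hq1 : 0 < q - 1 := by linarith
  induction k with
  | zero =>
    intro m _
    have := seqVal_le hq (hd.shf (m + 1))
    simp only [pow_zero, div_one]; linarith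
  | succ k ih =>
    intro m hm
    have hpos : 0 ≤ (1 / (q - 1)) / q ^ (k + 1) := by positivity
    rcases lex_tri (shf (m + 1) d) a with h1 | ⟨j, hj, hlt⟩ | h1
    · rw [h1, hav]; linarith
    · have haj := ha j
      have h1 : shf (m + 1) d j = 0 := by omega
      have h2 : a j = 1 := by omega
      have h3 := seqVal_diff hq (hd.shf (m + 1)) ha j hj
      have h4 := ih (j + (m + 1)) h1
      rw [shf_shf, h1, h2, hav] at h3
      have h5 := seqVal_nonneg hq (shf (j + 1) a)
      have h7 : j + 1 + (m + 1) = j + (m + 1) + 1 := by ring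
      rw [h7] at h3
      push_cast at h3
      have h6 : (0 : ℝ) < 1 / q ^ (j + 1) := by positivity
      have h8 : (1 / q ^ (j + 1)) * (0 - 1 + seqVal q (shf (j + (m + 1) + 1) d)
          - seqVal q (shf (j + 1) a)) ≤ (1 / q ^ (j + 1)) * ((1 / (q - 1)) / q ^ k) :=
        mul_le_mul_of_nonneg_left (by linarith) h6.le
      have h9 : (1 / q ^ (j + 1)) ≤ 1 / q := by
        apply one_div_le_one_div_of_le hqp
        calc q = q ^ 1 := (pow_one q).symm
          _ ≤ q ^ (j + 1) := pow_le_pow_right₀ hq.le (by omega)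
      have h10 : (1 / q ^ (j + 1)) * ((1 / (q - 1)) / q ^ k) ≤ (1 / q) * ((1 / (q - 1)) / q ^ k) :=
        mul_le_mul_of_nonneg_right h9 (by positivity)
      have h11 : (1 / q) * ((1 / (q - 1)) / q ^ k) = (1 / (q - 1)) / q ^ (k + 1) := by
        rw [pow_succ]; field_simp
      linarith
    · exact absurd h1 (h m hm)

lemma lex_le_one {q : ℝ} (hq : 1 < q) {a d : ℕ → ℕ} (ha : Bin a) (hd : Bin d)
    (hav : seqVal q a = 1)
    (h : ∀ m, d m = 0 → ¬ seqLt a (shf (m + 1) d)) (m : ℕ) (hm : d m = 0) :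
    seqVal q (shf (m + 1) d) ≤ 1 := by
  have t3 : Tendsto (fun k : ℕ => 1 + (1 / (q - 1)) / q ^ k) atTop (𝓝 (1 + 0)) :=
    tendsto_const_nhds.add
      (tendsto_const_nhds.div_atTop (tendsto_pow_atTop_atTop_of_one_lt hq))
  rw [add_zero] at t3
  exact ge_of_tendsto' t3 (fun k => lex_le_one_aux hq ha hd hav h k m hm)

/-- a sequence with value `< 1` is lexicographically smaller than `a` -/
lemma lex_of_val {q : ℝ} (hq : 1 < q) {a t : ℕ → ℕ} (ha : Bin a) (ht : Bin t)
    (hav : seqVal q a = 1) (h : ∀ m, ¬ seqLt a (shf (m + 1) a)) (htv : seqVal q t < 1) :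
    seqLt t a := by
  rcases lex_tri t a with h1 | h1 | ⟨j, hj, hlt⟩
  · rw [h1] at htv; linarith
  · exact h1
  · exfalso
    have htj := ht j
    have h1 : a j = 0 := by omega
    have h2 : t j = 1 := by omega
    have h3 := seqVal_diff hq ha ht j hj
    have h4 := lex_le_one hq ha ha hav (fun m _ => h m) j h1
    have h5 := seqVal_nonneg hq (shf (j + 1) t)
    have h6 : (0 : ℝ) < 1 / q ^ (j + 1) := by positivity
    rw [h1, h2] at h3
    push_cast at h3
    have : (1 / q ^ (j + 1)) * (0 - 1 + seqVal q (shf (j + 1) a) - seqVal q (shf (j + 1) t)) ≤ 0 :=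
      mul_nonpos_of_nonneg_of_nonpos h6.le (by linarith)
    linarith

lemma tm_bin {τ : ℕ → ℕ} (hτ : IsThueMorse τ) : Bin τ := by
  intro i
  induction i using Nat.strong_induction_on with
  | _ i ih =>
    rcases Nat.even_or_odd' i with ⟨k, rfl | rfl⟩
    · rcases Nat.eq_zero_or_pos k with rfl | hk
      · simp [hτ.1]
      · rw [hτ.2.1]; exact ih k (by omega)
    · rw [hτ.2.2]; omega

lemma tm_pow {τ : ℕ → ℕ} (hτ : IsThueMorse τ) (n : ℕ) : τ (2 ^ n) = 1 := by
  induction n with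
  | zero => have := hτ.2.2 0; simpa [hτ.1] using this
  | succ n ih => rw [pow_succ, mul_comm, hτ.2.1, ih]

lemma tm_add {τ : ℕ → ℕ} (hτ : IsThueMorse τ) (n : ℕ) :
    ∀ r, r < 2 ^ n → τ (2 ^ n + r) = 1 - τ r := by
  induction n with
  | zero =>
    intro r hr
    have : r = 0 := by simpa using hr
    subst this
    simpa using hτ.2.2 0
  | succ n ih =>
    intro r hr
    rw [pow_succ] at hr ⊢
    rcases Nat.even_or_odd' r with ⟨k, rfl | rfl⟩
    · rw [show 2 ^ n * 2 + 2 * k = 2 * (2 ^ n + k) by ring, hτ.2.1, hτ.2.1, ih k (by omega)]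
    · rw [show 2 ^ n * 2 + (2 * k + 1) = 2 * (2 ^ n + k) + 1 by ring, hτ.2.2, hτ.2.2,
        ih k (by omega)]

/-- the periodic sequence `b_n(k) = τ (k mod 2^n)` -/
def bb (τ : ℕ → ℕ) (n k : ℕ) : ℕ := τ (k % 2 ^ n)

lemma bb_even {τ : ℕ → ℕ} (hτ : IsThueMorse τ) (n k : ℕ) : bb τ (n + 1) (2 * k) = bb τ n k := by
  unfold bb
  rw [pow_succ, mul_comm (2 ^ n) 2, Nat.mul_mod_mul_left, hτ.2.1]

lemma bb_odd {τ : ℕ → ℕ} (hτ : IsThueMorse τ) (n k : ℕ) :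
    bb τ (n + 1) (2 * k + 1) = 1 - bb τ n k := by
  unfold bb
  have : (2 * k + 1) % (2 ^ (n + 1)) = 2 * (k % 2 ^ n) + 1 := by
    rw [pow_succ, mul_comm (2 ^ n) 2, Nat.mod_mul,
      show (2 * k + 1) / 2 = k by omega]
    omega
  rw [this, hτ.2.2]

/-- the quasi-greedy sequence -/
def al (τ : ℕ → ℕ) (n : ℕ) : ℕ → ℕ := fun i => bb τ n (i + 1)

lemma bb_le {τ : ℕ → ℕ} (hτ : IsThueMorse τ) (n k : ℕ) : bb τ n k ≤ 1 := tm_bin hτ _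

lemma al_bin {τ : ℕ → ℕ} (hτ : IsThueMorse τ) (n : ℕ) : Bin (al τ n) := fun _ => tm_bin hτ _

/-- main lexicographic property: shifts of `al` are at most `al` -/
lemma al_shift {τ : ℕ → ℕ} (hτ : IsThueMorse τ) (n : ℕ) :
    ∀ m, ¬ seqLt (al τ n) (shf m (al τ n)) := by
  induction n with
  | zero =>
    rintro m ⟨j, -, hj⟩
    simp [al, shf, bb, Nat.mod_one, hτ.1] at hj
  | succ n ih =>
    rintro m ⟨j, hj, hlt⟩
    simp only [al, shf] at hj hlt
    have hb0 : bb τ n 0 = 0 := by simp [bb, hτ.1]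
    have h1 : bb τ (n + 1) 1 = 1 := by
      have := bb_odd hτ n 0
      simpa [hb0] using this
    have hj0 : j ≠ 0 := by
      rintro rfl
      have := bb_le hτ (n + 1) (0 + m + 1)
      simp only [zero_add] at hlt this
      omega
    have h0 := hj 0 (by omega)
    simp only [zero_add] at h0
    rw [h1] at h0
    rcases Nat.even_or_odd' m with ⟨k, rfl | rfl⟩
    · -- even shift
      rw [bb_odd] at h0
      · have hk : bb τ n k = 0 := by omega
        rcases Nat.even_or_odd' j with ⟨l, rfl | rfl⟩
        · -- j = 2l, value index 2l+1
          rw [show 2 * l + 2 * k + 1 = 2 * (l + k) + 1 by ring, bb_odd hτ, bb_odd hτ] at hlt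
          have h2 := hj (2 * l - 1) (by omega)
          rw [show 2 * l - 1 + 1 = 2 * l by omega, show 2 * l - 1 + 2 * k + 1 = 2 * (l + k) by omega,
            bb_even hτ, bb_even hτ] at h2
          omega
        · rw [show 2 * l + 1 + 2 * k + 1 = 2 * (l + k + 1) by ring,
            show 2 * l + 1 + 1 = 2 * (l + 1) by ring, bb_even hτ, bb_even hτ] at hlt
          refine ih k ⟨l, fun i hi => ?_, hlt⟩
          have h2 := hj (2 * i + 1) (by omega)
          rw [show 2 * i + 1 + 2 * k + 1 = 2 * (i + k + 1) by ring,
            show 2 * i + 1 + 1 = 2 * (i + 1) by ring, bb_even hτ, bb_even hτ] at h2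
          exact h2
      · exact hτ
    · rw [show 2 * k + 1 + 1 = 2 * (k + 1) by ring, bb_even hτ] at h0
      have h2 : bb τ (n + 1) 2 = bb τ n 1 := bb_even hτ n 1
      have h3 : bb τ (n + 1) (2 * (k + 1) + 1) = 0 := by rw [bb_odd hτ]; omega
      have hn : bb τ n 1 = 1 := by
        rcases n with _ | n
        · simp [bb, Nat.mod_one, hτ.1] at h0
        · have := bb_odd hτ n 0
          simpa [bb, hτ.1] using this
      by_cases hj1 : j = 1
      · subst hj1
        rw [show 1 + (2 * k + 1) + 1 = 2 * (k + 1) + 1 by ring] at hlt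
        omega
      · have h4 := hj 1 (by omega)
        rw [show 1 + (2 * k + 1) + 1 = 2 * (k + 1) + 1 by ring] at h4
        norm_num at h4
        omega

lemma al_val {τ : ℕ → ℕ} (hτ : IsThueMorse τ) (n : ℕ) {q : ℝ} (hq : 1 < q)
    (h : (1 : ℝ) = ∑ i ∈ Finset.range (2 ^ n), (τ (i + 1) : ℝ) / q ^ (i + 1)) :
    seqVal q (al τ n) = 1 := by
  have h1 := seqVal_split hq (al_bin hτ n) (2 ^ n)
  have hs : shf (2 ^ n) (al τ n) = al τ n := by
    funext i
    simp only [shf, al, bb]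
    rw [show i + 2 ^ n + 1 = i + 1 + 2 ^ n by ring, Nat.add_mod_right]
  rw [hs] at h1
  obtain ⟨N, hN⟩ : ∃ N, 2 ^ n = N + 1 := ⟨2 ^ n - 1, by have := Nat.one_le_two_pow (n := n); omega⟩
  have hl : al τ n N = 0 := by simp [al, bb, ← hN, hτ.1]
  have ht : τ (N + 1) = 1 := by rw [← hN]; exact tm_pow hτ n
  have hc : ∑ i ∈ Finset.range N, (al τ n i : ℝ) / q ^ (i + 1)
      = ∑ i ∈ Finset.range N, (τ (i + 1) : ℝ) / q ^ (i + 1) := by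
    refine Finset.sum_congr rfl (fun i hi => ?_)
    have := Finset.mem_range.1 hi
    simp only [al, bb]
    rw [Nat.mod_eq_of_lt (by omega)]
  rw [hN, Finset.sum_range_succ] at h h1
  rw [hl, hc] at h1
  rw [ht] at h
  push_cast at h h1
  have hx : (1 : ℝ) < q ^ (N + 1) := one_lt_pow₀ hq (by omega)
  have hy : 1 / q ^ (N + 1) < 1 := by rw [div_lt_one (by linarith)]; exact hx
  have h5 : (seqVal q (al τ n) - 1) * (1 - 1 / q ^ (N + 1)) = 0 := by
    rw [zero_div] at h1
    linear_combination h1 - h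
  rcases mul_eq_zero.1 h5 with h6 | h6 <;> linarith

lemma al_half {τ : ℕ → ℕ} (hτ : IsThueMorse τ) (n i : ℕ) :
    al τ (n + 1) (i + 2 ^ n) = 1 - al τ (n + 1) i := by
  simp only [al, bb]
  have hp := Nat.two_pow_pos n
  have hP : 2 ^ (n + 1) = 2 ^ n + 2 ^ n := by ring
  have hr := Nat.mod_lt (i + 1) (show 0 < 2 ^ (n + 1) by positivity)
  rw [show i + 2 ^ n + 1 = (i + 1) + 2 ^ n by ring, Nat.add_mod,
    Nat.mod_eq_of_lt (show 2 ^ n < 2 ^ (n + 1) by omega)]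
  generalize (i + 1) % 2 ^ (n + 1) = r at hr ⊢
  by_cases h : r < 2 ^ n
  · rw [Nat.mod_eq_of_lt (by omega), add_comm, tm_add hτ n r h]
  · have h2 : (r + 2 ^ n) % 2 ^ (n + 1) = r - 2 ^ n := by
      rw [Nat.mod_eq_sub_mod (by omega), Nat.mod_eq_of_lt (by omega)]
      omega
    rw [h2]
    have h3 := tm_add hτ n (r - 2 ^ n) (by omega)
    rw [show 2 ^ n + (r - 2 ^ n) = r by omega] at h3
    have := tm_bin hτ (r - 2 ^ n)
    omega

/-- lexicographic criterion -/
def LexCrit (a d : ℕ → ℕ) : Prop :=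
  ∀ m, (d m = 0 → seqLt (shf (m + 1) d) a) ∧ (d m = 1 → seqLt (shf (m + 1) (flp d)) a)

lemma LexCrit.flp {a d : ℕ → ℕ} (hd : Bin d) (h : LexCrit a d) : LexCrit a (flp d) := by
  intro m
  rw [flp_flp hd]
  have := hd m
  refine ⟨fun hm => (h m).2 ?_, fun hm => (h m).1 ?_⟩ <;> · unfold _root_.flp at hm; omega

lemma no_prefix {τ : ℕ → ℕ} (hτ : IsThueMorse τ) (n : ℕ) {d : ℕ → ℕ} (hd : Bin d)
    (h : LexCrit (al τ (n + 1)) d) (m : ℕ) (hm : d m = 0)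
    (hw : ∀ i, i < 2 ^ n → d (i + (m + 1)) = τ (i + 1)) : False := by
  have hp := Nat.two_pow_pos n
  have hP : 2 ^ (n + 1) = 2 ^ n + 2 ^ n := by ring
  have hA : ∀ i, i < 2 ^ n → al τ (n + 1) i = τ (i + 1) := fun i hi => by
    simp only [al, bb]; rw [Nat.mod_eq_of_lt (by omega)]
  obtain ⟨j, hj, hjl⟩ := (h m).1 hm
  have h1 : d (m + 2 ^ n) = 1 := by
    have := hw (2 ^ n - 1) (by omega)
    rw [show 2 ^ n - 1 + (m + 1) = m + 2 ^ n by omega, show 2 ^ n - 1 + 1 = 2 ^ n by omega,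
      tm_pow hτ] at this
    exact this
  obtain ⟨k, hk, hkl⟩ := (h (m + 2 ^ n)).2 h1
  simp only [shf, flp] at hj hjl hk hkl
  have hjN : 2 ^ n ≤ j := by
    by_contra hc
    push Not at hc
    rw [hw j hc, hA j hc] at hjl
    omega
  obtain ⟨l, rfl⟩ := Nat.exists_eq_add_of_le' hjN
  have e : ∀ i, i + 2 ^ n + (m + 1) = i + (m + 2 ^ n + 1) := fun i => by ring
  rw [al_half hτ, e] at hjl
  rcases lt_trichotomy k l with hkl' | rfl | hkl'
  · have h2 := hj (k + 2 ^ n) (by omega)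
    rw [al_half hτ, e] at h2
    have := al_bin hτ (n + 1) k
    omega
  · omega
  · have h2 := hk l hkl'
    have := hd (l + (m + 2 ^ n + 1))
    omega

lemma lex_descend {τ : ℕ → ℕ} (hτ : IsThueMorse τ) (n : ℕ) {d : ℕ → ℕ} (hd : Bin d)
    (h : LexCrit (al τ (n + 1)) d) (m : ℕ) (hm : d m = 0) :
    ¬ seqLt (al τ n) (shf (m + 1) d) := by
  rintro ⟨j, hj, hjl⟩
  have hp := Nat.two_pow_pos n
  have hP : 2 ^ (n + 1) = 2 ^ n + 2 ^ n := by ring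
  have hper : ∀ a i, al τ n (i + 2 ^ n * a) = al τ n i := fun a i => by
    simp only [al, bb]
    rw [show i + 2 ^ n * a + 1 = i + 1 + 2 ^ n * a by ring, Nat.add_mul_mod_self_left]
  have hA : ∀ i, i < 2 ^ n → al τ (n + 1) i = τ (i + 1) := fun i hi => by
    simp only [al, bb]; rw [Nat.mod_eq_of_lt (by omega)]
  have hB : ∀ i, i + 1 < 2 ^ n → al τ n i = τ (i + 1) := fun i hi => by
    simp only [al, bb]; rw [Nat.mod_eq_of_lt (by omega)]
  have hC : al τ n (2 ^ n - 1) = 0 := by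
    simp only [al, bb]; rw [show 2 ^ n - 1 + 1 = 2 ^ n by omega, Nat.mod_self, hτ.1]
  obtain ⟨a, r, hr, rfl⟩ : ∃ a r, r < 2 ^ n ∧ j = r + 2 ^ n * a :=
    ⟨j / 2 ^ n, j % 2 ^ n, Nat.mod_lt _ hp, (Nat.mod_add_div j (2 ^ n)).symm⟩
  simp only [shf] at hj hjl
  -- the start of the block comes after a zero
  have hz : d (m + 2 ^ n * a) = 0 := by
    rcases Nat.eq_zero_or_pos a with rfl | ha
    · simpa using hm
    · obtain ⟨b, rfl⟩ : ∃ b, a = b + 1 := ⟨a - 1, by omega⟩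
      have hmul : 2 ^ n * (b + 1) = 2 ^ n * b + 2 ^ n := by ring
      have h2 := hj (2 ^ n - 1 + 2 ^ n * b) (by omega)
      rw [hper, hC] at h2
      rw [h2]; congr 1; omega
  have hu : ∀ i, i < r → d (i + (m + 2 ^ n * a + 1)) = al τ n i := fun i hi => by
    have h2 := hj (i + 2 ^ n * a) (by omega)
    rw [hper] at h2
    rw [h2]; congr 1; ring
  have hur : al τ n r < d (r + (m + 2 ^ n * a + 1)) := by
    rw [hper] at hjl
    rwa [show r + 2 ^ n * a + (m + 1) = r + (m + 2 ^ n * a + 1) by ring] at hjl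
  have hdr := hd (r + (m + 2 ^ n * a + 1))
  by_cases hrN : r + 1 = 2 ^ n
  · refine no_prefix hτ n hd h (m + 2 ^ n * a) hz (fun i hi => ?_)
    rcases Nat.lt_or_ge i r with hir | hir
    · rw [hu i hir, hB i (by omega)]
    · have : i = r := by omega
      subst this
      rw [hrN, tm_pow hτ]; omega
  · obtain ⟨k, hk, hkl⟩ := (h (m + 2 ^ n * a)).1 hz
    simp only [shf] at hk hkl
    rw [hB r (by omega)] at hur
    rcases lt_trichotomy k r with h3 | rfl | h3
    · rw [hu k h3, hB k (by omega), hA k (by omega)] at hkl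
      omega
    · rw [hA k hr] at hkl; omega
    · have := hk r h3
      rw [hA r hr] at this; omega

/-- `U_{q_{n+1}}' ⊆ U_q'` for `q > q_n`. -/
lemma USeq_stable {τ : ℕ → ℕ} (hτ : IsThueMorse τ) {Q : ℕ → ℝ} (hQ : IsBaseSeq τ Q) (n : ℕ)
    (hn : 1 ≤ n) {q : ℝ} (hq : Q n < q) (hq2 : q < 2) {d : ℕ → ℕ} (hd : d ∈ USeq (Q (n + 1))) :
    d ∈ USeq q := by
  obtain ⟨a1, a2, a3⟩ := hQ.2 n hn
  obtain ⟨b1, b2, b3⟩ := hQ.2 (n + 1) (by omega)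
  rw [USeq_iff b1 b2] at hd
  obtain ⟨hB, hc⟩ := hd
  have hL : LexCrit (al τ (n + 1)) d := fun m =>
    ⟨fun hm => lex_of_val b1 (al_bin hτ _) (hB.shf _) (al_val hτ _ b1 b3)
        (fun m => al_shift hτ _ _) ((hc m).1 hm),
     fun hm => lex_of_val b1 (al_bin hτ _) ((Bin.flp d).shf _) (al_val hτ _ b1 b3)
        (fun m => al_shift hτ _ _) ((hc m).2 hm)⟩
  rw [USeq_iff (by linarith) hq2]
  refine ⟨hB, fun m => ⟨fun hm => ?_, fun hm => ?_⟩⟩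
  · exact lt_one_mono a1 hq (hB.shf _) (lex_le_one a1 (al_bin hτ n) hB (al_val hτ n a1 a3)
      (lex_descend hτ n hB hL) m hm)
  · exact lt_one_mono a1 hq ((Bin.flp d).shf _) (lex_le_one a1 (al_bin hτ n) (Bin.flp d)
      (al_val hτ n a1 a3)
      (lex_descend hτ n (Bin.flp d) (hL.flp hB)) m (by simp [flp, hm]))

/-- Let `n ≥ 2` and `x ∈ D_n \ ⋃_{k=1}^{n-1} D_k`. If `(γ_i)` is the
lexicographically smallest sequence in `U_{q_n}'` with `((γ_i))_{q_{n-1}} > x`, and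
`q* ∈ (q_{n-1}, q_n]` satisfies `x = ((γ_i))_{q*}`, then `q_s(x) = q*`. -/
theorem qs_eq_of_min_seq (τ : ℕ → ℕ) (hτ : IsThueMorse τ)
    (Q : ℕ → ℝ) (hQ : IsBaseSeq τ Q) (n : ℕ) (hn : 2 ≤ n)
    (x : ℝ) (hx : x ∈ D Q n \ ⋃ k ∈ Finset.Icc 1 (n - 1), D Q k)
    (γ : ℕ → ℕ) (hγ : γ ∈ USeq (Q n)) (hγx : x < seqVal (Q (n - 1)) γ)
    (hmin : ∀ δ ∈ USeq (Q n), x < seqVal (Q (n - 1)) δ → ¬ seqLt δ γ)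
    (qstar : ℝ) (hq : qstar ∈ Set.Ioc (Q (n - 1)) (Q n))
    (hxq : x = seqVal qstar γ) :
    qs x = qstar := by
  obtain ⟨n, rfl⟩ : ∃ k, n = k + 2 := ⟨n - 2, by omega⟩
  simp only [show n + 2 - 1 = n + 1 by omega] at hx hγx hmin hq
  obtain ⟨a1, a2, a3⟩ := hQ.2 (n + 1) (by omega)
  obtain ⟨b1, b2, b3⟩ := hQ.2 (n + 2) (by omega)
  obtain ⟨hxD, hxn⟩ := hx
  -- no base up to `Q (n + 1)` is univoque for `x`
  have hlow : ∀ q, 1 < q → q ≤ Q (n + 1) → ¬ HasUniqueExpansion q x := by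
    classical
    intro q hq1 hqn hu
    have hex : ∃ k, q ≤ Q k := ⟨n + 1, hqn⟩
    have hk1 : q ≤ Q (Nat.find hex) := Nat.find_spec hex
    have hk2 : Nat.find hex ≤ n + 1 := Nat.find_min' hex hqn
    have hk3 : 1 ≤ Nat.find hex := by
      by_contra hc
      have : Nat.find hex = 0 := by omega
      rw [this, hQ.1] at hk1
      linarith
    have hk4 : Q (Nat.find hex - 1) < q := by
      have := Nat.find_min hex (show Nat.find hex - 1 < Nat.find hex by omega)
      push Not at this
      exact this
    apply hxn
    simp only [Set.mem_iUnion, D]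
    refine ⟨Nat.find hex, Finset.mem_Icc.2 ⟨hk3, hk2⟩, q, ⟨hk4, hk1⟩, ?_, hu⟩
    obtain ⟨d, hd, -⟩ := hu
    rw [hd.2]
    exact ⟨seqVal_nonneg hq1 d, seqVal_le hq1 hd.1⟩
  have hγB : Bin γ := hγ.1
  have hq1 : 1 < qstar := a1.trans hq.1
  have hq2 : qstar < 2 := hq.2.trans_lt b2
  have hx0 : x ≠ 0 := by
    rintro h0
    apply hlow (Q (n + 1)) a1 le_rfl
    have hz : (fun _ => 0 : ℕ → ℕ) ∈ USeq (Q (n + 1)) := by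
      rw [USeq_iff a1 a2]
      refine ⟨fun i => by simp, fun m => ⟨fun _ => ?_, fun hm => by simp at hm⟩⟩
      rw [seqVal_zero (by intro i; rfl)]; norm_num
    have hv : seqVal (Q (n + 1)) (fun _ => 0) = 0 := seqVal_zero (fun _ => rfl)
    refine ⟨fun _ => 0, ⟨fun i => by simp, by rw [h0, hv]⟩, fun e he => ?_⟩
    apply hz.2 e
    rw [hv, ← h0]; exact he
  have hstar : qstar ∈ UBases x := by
    have := USeq_stable hτ hQ (n + 1) (by omega) hq.1 hq2 hγ
    refine ⟨hq1, hq2, γ, ⟨hγB, hxq⟩, fun e he => this.2 e ?_⟩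
    rw [← hxq]; exact he
  refine le_antisymm (csInf_le ⟨1, fun q hq => hq.1.le⟩ hstar) (le_csInf ⟨_, hstar⟩ ?_)
  rintro q ⟨hu1, hu2, hu⟩
  by_contra hlt
  push Not at hlt
  have hqn : Q (n + 1) < q := by
    by_contra hc
    push Not at hc
    exact hlow q hu1 hc hu
  obtain ⟨δ, hδ, hδu⟩ := hu
  have hδB : Bin δ := hδ.1
  have hδU : δ ∈ USeq q := ⟨hδ.1, fun e he => hδu e (by rw [← hδ.2] at he; exact he)⟩
  have hδn : δ ∈ USeq (Q (n + 2)) := USeq_mono hu1 (by linarith [hq.2]) b2 hδU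
  have hδ0 : ∃ i, δ i ≠ 0 := by
    by_contra hc
    push Not at hc
    exact hx0 (by rw [hδ.2, seqVal_zero hc])
  have hγ0 : ∃ i, γ i ≠ 0 := by
    by_contra hc
    push Not at hc
    exact hx0 (by rw [hxq, seqVal_zero hc])
  have h1 : x < seqVal (Q (n + 1)) δ := by
    conv_lhs => rw [hδ.2]
    exact seqVal_lt a1 hqn hδB hδ0
  have h2 := hmin δ hδn h1
  have h3 : x < seqVal q γ := by
    conv_lhs => rw [hxq]
    exact seqVal_lt hu1 hlt hγB hγ0
  have hγq : γ ∈ USeq q := USeq_stable hτ hQ (n + 1) (by omega) hqn hu2 hγ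
  have hδx := hδ.2
  rcases lex_tri δ γ with h4 | h4 | h4
  · rw [← h4] at h3; linarith
  · exact h2 h4
  · have := USeq_lex_lt hu1 hu2 hγq hδU h4
    linarith
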